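/- Let [A] be an interval m×n matrix with entrywise bounds A̲ ≤ A ≤ Ā and let [b] = [b̲, b̄] be an interval vector in ℝ^m. Then x ∈ ℝ^n belongs to the tolerance solution set Σ_∀∃([A],[b]) if and only if there exist x₁, x₂ ∈ ℝ^n with x₁ ≥ 0, x₂ ≥ 0, x = x₁ − x₂, Ā x₁ − A̲ x₂ ≤ b̄, and A̲ x₁ − Ā x₂ ≥ b̲ (all inequalities componentwise). -/

import Mathlib

open Matrix Finset

/-- Rohn's characterization of tolerance solutions: `x ∈ Σ_∀∃([A],[b])`
iff `x = x₁ − x₂` with `x₁, x₂ ≥ 0`, `Ā x₁ − A̲ x₂ ≤ b̄` and `A̲ x₁ − Ā x₂ ≥ b̲`. -/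
theorem tolerance_solution_iff_rohn
    {m n : ℕ} (Al Au : Matrix (Fin m) (Fin n) ℝ) (hA : ∀ i j, Al i j ≤ Au i j)
    (bl bu : Fin m → ℝ) (x : Fin n → ℝ) :
    (∀ A : Matrix (Fin m) (Fin n) ℝ, (∀ i j, Al i j ≤ A i j ∧ A i j ≤ Au i j) →
        ∀ i, bl i ≤ A.mulVec x i ∧ A.mulVec x i ≤ bu i) ↔
    (∃ x₁ x₂ : Fin n → ℝ,
      (∀ j, 0 ≤ x₁ j) ∧ (∀ j, 0 ≤ x₂ j) ∧ x = x₁ - x₂ ∧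
      (∀ i, Au.mulVec x₁ i - Al.mulVec x₂ i ≤ bu i) ∧
      (∀ i, bl i ≤ Al.mulVec x₁ i - Au.mulVec x₂ i)) := by
  constructor
  · intro h
    refine ⟨fun j => max (x j) 0, fun j => max (-x j) 0, fun j => le_max_right _ _,
      fun j => le_max_right _ _, ?_, ?_, ?_⟩
    · funext j
      simp only [Pi.sub_apply]
      rcases le_total 0 (x j) with hx | hx
      · rw [max_eq_left hx, max_eq_right (by linarith)]; ring
      · rw [max_eq_right hx, max_eq_left (by linarith)]; ring
    · intro i
      have h1 := (h (fun i j => if 0 ≤ x j then Au i j else Al i j) (by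
        intro i j
        have := hA i j
        split_ifs
        · exact ⟨this, le_refl _⟩
        · exact ⟨le_refl _, this⟩) i).2
      refine le_trans (le_of_eq ?_) h1
      simp only [Matrix.mulVec, dotProduct]
      rw [← Finset.sum_sub_distrib]
      refine Finset.sum_congr rfl fun j _ => ?_
      split_ifs with hx
      · rw [max_eq_left hx, max_eq_right (by linarith)]; ring
      · rw [max_eq_right (by linarith), max_eq_left (by linarith)]; ring
    · intro i
      have h1 := (h (fun i j => if 0 ≤ x j then Al i j else Au i j) (by
        intro i j
        have := hA i j
        split_ifs
        · exact ⟨le_refl _, this⟩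
        · exact ⟨this, le_refl _⟩) i).1
      refine le_trans h1 (le_of_eq ?_)
      simp only [Matrix.mulVec, dotProduct]
      rw [← Finset.sum_sub_distrib]
      refine Finset.sum_congr rfl fun j _ => ?_
      split_ifs with hx
      · rw [max_eq_left hx, max_eq_right (by linarith)]; ring
      · rw [max_eq_right (by linarith), max_eq_left (by linarith)]; ring
  · rintro ⟨x₁, x₂, h1, h2, rfl, hu, hl⟩ A hAA i
    constructor
    · refine le_trans (hl i) ?_
      simp only [Matrix.mulVec, dotProduct, Pi.sub_apply]
      rw [← Finset.sum_sub_distrib]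
      refine Finset.sum_le_sum fun j _ => ?_
      have ha := mul_le_mul_of_nonneg_right (hAA i j).1 (h1 j)
      have hb := mul_le_mul_of_nonneg_right (hAA i j).2 (h2 j)
      rw [mul_sub]
      linarith
    · refine le_trans ?_ (hu i)
      simp only [Matrix.mulVec, dotProduct, Pi.sub_apply]
      rw [← Finset.sum_sub_distrib]
      refine Finset.sum_le_sum fun j _ => ?_
      have ha := mul_le_mul_of_nonneg_right (hAA i j).2 (h1 j)
      have hb := mul_le_mul_of_nonneg_right (hAA i j).1 (h2 j)
      rw [mul_sub]
      linarith
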